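/- Let (C, d) be a chain complex of R-modules and let h be a degree +1 family of R-linear maps h_q : C_q → C_{q+1} satisfying h ∘ h = 0 and h ∘ d ∘ h = h. Then D := d ∘ h + h ∘ d is an idempotent chain endomorphism of C (D ∘ D = D and d ∘ D = D ∘ d); the complex C splits as the direct sum of the subcomplexes ker D and im D; the subcomplex im D is acyclic (all its homology vanishes); h commutes with D and vanishes on ker D; and the triple (id − D, γ, h), where γ : ker D → C is the canonical inclusion, is a reduction from C onto the subcomplex ker D. -/

import Mathlib

/-!
Common setup: chain complexes of `R`-modules indexed by `ℤ`.

We index differentials so that `C.d q : C.X (q+1) →ₗ[R] C.X q` is the differential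
going out of degree `q+1`; since `q` ranges over all of `ℤ`, this gives the
differential at every degree.
-/

universe u

/-- A chain complex of `R`-modules: a `ℤ`-indexed family of `R`-modules together with
`R`-linear differentials `d : C_{q+1} → C_q` satisfying `d ∘ d = 0`. -/
structure ChainCpx (R : Type u) [CommRing R] : Type (u + 1) where
  X : ℤ → Type u
  acg : ∀ q, AddCommGroup (X q)
  mod : ∀ q, Module R (X q)
  d : ∀ q : ℤ, X (q + 1) →ₗ[R] X q
  dd : ∀ (q : ℤ) (x : X (q + 1 + 1)), d q (d (q + 1) x) = 0

attribute [instance] ChainCpx.acg ChainCpx.mod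

variable {R : Type u} [CommRing R]

/-- A reduction `ρ = (f, g, h)` from a chain complex `Cbig` to a chain complex `Csmall`:
`f`, `g` are chain maps, `h` is a degree `+1` homotopy operator on `Cbig`, satisfying
`f ∘ g = id`, `g ∘ f + d ∘ h + h ∘ d = id`, `f ∘ h = 0`, `h ∘ g = 0`, `h ∘ h = 0`. -/
structure Reduction (Cbig Csmall : ChainCpx R) where
  f : ∀ q : ℤ, Cbig.X q →ₗ[R] Csmall.X q
  g : ∀ q : ℤ, Csmall.X q →ₗ[R] Cbig.X q
  h : ∀ q : ℤ, Cbig.X q →ₗ[R] Cbig.X (q + 1)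
  f_chain : ∀ (q : ℤ) (x : Cbig.X (q + 1)), Csmall.d q (f (q + 1) x) = f q (Cbig.d q x)
  g_chain : ∀ (q : ℤ) (y : Csmall.X (q + 1)), Cbig.d q (g (q + 1) y) = g q (Csmall.d q y)
  fg : ∀ (q : ℤ) (y : Csmall.X q), f q (g q y) = y
  gf_dh_hd : ∀ (q : ℤ) (x : Cbig.X (q + 1)),
    g (q + 1) (f (q + 1) x) + Cbig.d (q + 1) (h (q + 1) x) + h q (Cbig.d q x) = x
  fh : ∀ (q : ℤ) (x : Cbig.X q), f (q + 1) (h q x) = 0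
  hg : ∀ (q : ℤ) (y : Csmall.X q), h q (g q y) = 0
  hh : ∀ (q : ℤ) (x : Cbig.X q), h (q + 1) (h q x) = 0


/-- The operator `D = d ∘ h + h ∘ d` associated with a degree `+1` operator `h`,
as an endomorphism of the degree `q+1` component. -/
def Dop (C : ChainCpx R) (h : ∀ q : ℤ, C.X q →ₗ[R] C.X (q + 1)) (q : ℤ) :
    C.X (q + 1) →ₗ[R] C.X (q + 1) :=
  (C.d (q + 1)).comp (h (q + 1)) + (h q).comp (C.d q)

/-- The subcomplex `ker D` of `C`, shifted by one: its degree `q` component is the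
kernel of `D` acting on `C_{q+1}`. -/
noncomputable def kerDCpx (C : ChainCpx R) (h : ∀ q : ℤ, C.X q →ₗ[R] C.X (q + 1)) :
    ChainCpx R where
  X q := ↥(LinearMap.ker (Dop C h q))
  acg _ := inferInstance
  mod _ := inferInstance
  d q := (C.d (q + 1)).restrict
    (p := LinearMap.ker (Dop C h (q + 1))) (q := LinearMap.ker (Dop C h q))
    (by
      intro x hx
      simp only [LinearMap.mem_ker, Dop, LinearMap.add_apply, LinearMap.comp_apply] at hx ⊢
      have h1 : h (q + 1) (C.d (q + 1) x) = - C.d (q + 1 + 1) (h (q + 1 + 1) x) :=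
        eq_neg_of_add_eq_zero_right hx
      rw [C.dd, map_zero, add_zero, h1, map_neg, C.dd, neg_zero])
  dd := by
    intro q x
    apply Subtype.ext
    simpa [LinearMap.restrict_apply] using C.dd (q + 1) (x : C.X (q + 1 + 1 + 1))

/-- The shift of a chain complex: `(shift1 A).X q = A.X (q+1)`. -/
def shift1 (A : ChainCpx R) : ChainCpx R where
  X q := A.X (q + 1)
  acg q := A.acg (q + 1)
  mod q := A.mod (q + 1)
  d q := A.d (q + 1)
  dd q := A.dd (q + 1)

section Dop

variable (C : ChainCpx R) (h : ∀ q : ℤ, C.X q →ₗ[R] C.X (q + 1))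

theorem Dop_apply (q : ℤ) (x : C.X (q + 1)) :
    Dop C h q x = C.d (q + 1) (h (q + 1) x) + h q (C.d q x) := rfl

theorem d_Dop (q : ℤ) (x : C.X (q + 1 + 1)) :
    C.d (q + 1) (Dop C h (q + 1) x) = Dop C h q (C.d (q + 1) x) := by
  simp [Dop_apply, C.dd]

variable {C h}

theorem Dop_Dop (hhh : ∀ (q : ℤ) (x : C.X q), h (q + 1) (h q x) = 0)
    (hdh : ∀ (q : ℤ) (x : C.X q), h q (C.d q (h q x)) = h q x) (q : ℤ) (x : C.X (q + 1)) :
    Dop C h q (Dop C h q x) = Dop C h q x := by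
  simp [Dop_apply, C.dd, hhh, hdh]

theorem h_Dop (hhh : ∀ (q : ℤ) (x : C.X q), h (q + 1) (h q x) = 0)
    (hdh : ∀ (q : ℤ) (x : C.X q), h q (C.d q (h q x)) = h q x) (q : ℤ) (x : C.X (q + 1)) :
    h (q + 1) (Dop C h q x) = h (q + 1) x := by
  simp [Dop_apply, hhh, hdh]

theorem Dop_h (hhh : ∀ (q : ℤ) (x : C.X q), h (q + 1) (h q x) = 0)
    (hdh : ∀ (q : ℤ) (x : C.X q), h q (C.d q (h q x)) = h q x) (q : ℤ) (x : C.X q) :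
    Dop C h q (h q x) = h q x := by
  simp [Dop_apply, hhh, hdh]

theorem h_eq_zero_of_mem_ker_Dop (hhh : ∀ (q : ℤ) (x : C.X q), h (q + 1) (h q x) = 0)
    (hdh : ∀ (q : ℤ) (x : C.X q), h q (C.d q (h q x)) = h q x) (q : ℤ) {x : C.X (q + 1)}
    (hx : x ∈ LinearMap.ker (Dop C h q)) : h (q + 1) x = 0 := by
  rw [← h_Dop hhh hdh, LinearMap.mem_ker.mp hx, map_zero]

/-- The map `id − D`, with codomain restricted to `ker D`. -/
noncomputable def idSubDop (hhh : ∀ (q : ℤ) (x : C.X q), h (q + 1) (h q x) = 0)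
    (hdh : ∀ (q : ℤ) (x : C.X q), h q (C.d q (h q x)) = h q x) (q : ℤ) :
    C.X (q + 1) →ₗ[R] LinearMap.ker (Dop C h q) :=
  (LinearMap.id - Dop C h q).codRestrict _ fun x => by simp [Dop_Dop hhh hdh]

/-- The reduction `(id − D, γ, h)` of `C` onto `ker D`. -/
noncomputable def kerDReduction (hhh : ∀ (q : ℤ) (x : C.X q), h (q + 1) (h q x) = 0)
    (hdh : ∀ (q : ℤ) (x : C.X q), h q (C.d q (h q x)) = h q x) :
    Reduction (shift1 C) (kerDCpx C h) where
  f q := idSubDop hhh hdh q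
  g q := (LinearMap.ker (Dop C h q)).subtype
  h q := h (q + 1)
  f_chain q (x : C.X (q + 1 + 1)) := Subtype.ext <| by
    change C.d (q + 1) (x - Dop C h (q + 1) x) = C.d (q + 1) x - Dop C h q (C.d (q + 1) x)
    rw [map_sub, d_Dop]
  g_chain _ _ := rfl
  fg q y := Subtype.ext <| by
    change (y.1 : C.X (q + 1)) - Dop C h q y.1 = y.1
    rw [LinearMap.mem_ker.mp y.2, sub_zero]
  gf_dh_hd q (x : C.X (q + 1 + 1)) := by
    change (x - Dop C h (q + 1) x) + C.d (q + 1 + 1) (h (q + 1 + 1) x)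
      + h (q + 1) (C.d (q + 1) x) = x
    exact (add_assoc _ _ _).trans (sub_add_cancel x (Dop C h (q + 1) x))
  fh q (x : C.X (q + 1)) := Subtype.ext <| by
    change h (q + 1) x - Dop C h (q + 1) (h (q + 1) x) = 0
    rw [Dop_h hhh hdh, sub_self]
  hg q y := h_eq_zero_of_mem_ker_Dop hhh hdh q y.2
  hh q x := hhh (q + 1) x

end Dop

/-- Let `(C, d)` be a chain complex and `h` a degree `+1` family of linear maps with
`h ∘ h = 0` and `h ∘ d ∘ h = h`.  Then `D := d∘h + h∘d` is an idempotent chain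
endomorphism of `C`; `C` splits as the direct sum of the subcomplexes `ker D` and
`im D`; the subcomplex `im D` is acyclic; `h` commutes with `D` and vanishes on
`ker D`; and `(id − D, γ, h)` is a reduction from `C` onto the subcomplex `ker D`
(`γ` being the canonical inclusion).  All degreewise assertions are stated on the
degree `q+1` components, `q` ranging over all of `ℤ`. -/
theorem statement3 (C : ChainCpx R) (h : ∀ q : ℤ, C.X q →ₗ[R] C.X (q + 1))
    (hhh : ∀ (q : ℤ) (x : C.X q), h (q + 1) (h q x) = 0)
    (hdh : ∀ (q : ℤ) (x : C.X q), h q (C.d q (h q x)) = h q x) :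
    -- `D` is idempotent
    (∀ (q : ℤ) (x : C.X (q + 1)), Dop C h q (Dop C h q x) = Dop C h q x) ∧
    -- `D` is a chain endomorphism: `d ∘ D = D ∘ d`
    (∀ (q : ℤ) (x : C.X (q + 1 + 1)),
      C.d (q + 1) (Dop C h (q + 1) x) = Dop C h q (C.d (q + 1) x)) ∧
    -- `C` splits as the direct sum `ker D ⊕ im D` in every degree
    (∀ q : ℤ, IsCompl (LinearMap.ker (Dop C h q)) (LinearMap.range (Dop C h q))) ∧
    -- `ker D` and `im D` are subcomplexes
    (∀ (q : ℤ) (x : C.X (q + 1 + 1)), x ∈ LinearMap.ker (Dop C h (q + 1)) →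
      C.d (q + 1) x ∈ LinearMap.ker (Dop C h q)) ∧
    (∀ (q : ℤ) (x : C.X (q + 1 + 1)), x ∈ LinearMap.range (Dop C h (q + 1)) →
      C.d (q + 1) x ∈ LinearMap.range (Dop C h q)) ∧
    -- the subcomplex `im D` is acyclic
    (∀ (q : ℤ) (x : C.X (q + 1)), x ∈ LinearMap.range (Dop C h q) → C.d q x = 0 →
      ∃ y ∈ LinearMap.range (Dop C h (q + 1)), C.d (q + 1) y = x) ∧
    -- `h` commutes with `D`
    (∀ (q : ℤ) (x : C.X (q + 1)), h (q + 1) (Dop C h q x) = Dop C h (q + 1) (h (q + 1) x)) ∧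
    -- `h` vanishes on `ker D`
    (∀ (q : ℤ) (x : C.X (q + 1)), x ∈ LinearMap.ker (Dop C h q) → h (q + 1) x = 0) ∧
    -- `(id − D, γ, h)` is a reduction from `C` onto the subcomplex `ker D`
    ∃ ρ : Reduction (shift1 C) (kerDCpx C h),
      (∀ (q : ℤ) (x : C.X (q + 1)),
        (LinearMap.ker (Dop C h q)).subtype (ρ.f q x) = x - Dop C h q x) ∧
      (∀ (q : ℤ) (y : ↥(LinearMap.ker (Dop C h q))), ρ.g q y = (y : C.X (q + 1))) ∧
      (∀ (q : ℤ) (x : C.X (q + 1)), ρ.h q x = h (q + 1) x) := by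
  refine ⟨Dop_Dop hhh hdh, d_Dop C h, fun q => ?_, fun q x hx => ?_, ?_, ?_,
    fun q x => by rw [h_Dop hhh hdh, Dop_h hhh hdh],
    fun q x => h_eq_zero_of_mem_ker_Dop hhh hdh q,
    kerDReduction hhh hdh, fun _ _ => rfl, fun _ _ => rfl, fun _ _ => rfl⟩
  · have hD : IsIdempotentElem (Dop C h q) := LinearMap.ext (Dop_Dop hhh hdh q)
    exact (LinearMap.IsIdempotentElem.isCompl hD).symm
  · rw [LinearMap.mem_ker, ← d_Dop, LinearMap.mem_ker.mp hx, map_zero]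
  · rintro q _ ⟨z, rfl⟩
    exact ⟨C.d (q + 1) z, (d_Dop C h q z).symm⟩
  · rintro q _ ⟨z, rfl⟩ hz
    refine ⟨h (q + 1) z, ⟨h (q + 1) z, Dop_h hhh hdh (q + 1) z⟩, ?_⟩
    have key := Dop_Dop hhh hdh q z
    rwa [Dop_apply C h q (Dop C h q z), hz, map_zero, add_zero, h_Dop hhh hdh] at key
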